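/- Proposition 2 (EUKF-A specializes to the Kalman filter for linear systems): if A is invertible and B·Bᵀ = n·(P + A⁻¹·Q·(A⁻¹)ᵀ), then P_prior^EUKFA = P_prior, P_z^EUKFA = C·P_prior·Cᵀ + R = R̄, P_ez^EUKFA = P_prior·Cᵀ; consequently the EUKF-A gain K^EUKFA := P_ez^EUKFA·(P_z^EUKFA)⁻¹ equals the Kalman gain K_KF = P_prior·Cᵀ·R̄⁻¹, and the EUKF-A posterior covariance P_prior^EUKFA − P_ez^EUKFA·(P_z^EUKFA)⁻¹·(P_ez^EUKFA)ᵀ equals the Kalman posterior covariance P_prior − P_prior·Cᵀ·R̄⁻¹·C·P_prior. -/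

import Mathlib

open Matrix

/-- UKF weight vector `W ∈ ℝ^{2n+1}`. -/
noncomputable def ukfW (n : ℕ) (α : ℝ) : Fin (2*n+1) → ℝ :=
  fun i => if i.val = 0 then (α^2 - 1)/α^2 else 1/(2*α^2*n)

/-- Perturbation matrix `Δ(α, B)`: first column 0, next n columns `α·bᵢ`,
last n columns `−α·bᵢ`. -/
noncomputable def ukfDelta (n : ℕ) (α : ℝ) (B : Matrix (Fin n) (Fin n) ℝ) :
    Matrix (Fin n) (Fin (2*n+1)) ℝ :=
  Matrix.of fun i j =>
    if h0 : j.val = 0 then 0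
    else if h1 : j.val ≤ n then α * B i ⟨j.val - 1, by omega⟩
    else -(α * B i ⟨j.val - n - 1, by have := j.isLt; omega⟩)

/-- Sigma-point matrix `X(x̂, α, B)`: j-th column is `x̂` plus the j-th column of `Δ(α, B)`. -/
noncomputable def sigmaPts {n : ℕ} (xhat : Fin n → ℝ) (α : ℝ)
    (B : Matrix (Fin n) (Fin n) ℝ) : Matrix (Fin n) (Fin (2*n+1)) ℝ :=
  Matrix.of fun i j => xhat i + ukfDelta n α B i j

/-- Affine propagation of an ensemble: j-th column of the result is `A·(j-th column of X) + u`. -/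
noncomputable def propagate {n : ℕ} (A : Matrix (Fin n) (Fin n) ℝ) (u : Fin n → ℝ)
    (X : Matrix (Fin n) (Fin (2*n+1)) ℝ) : Matrix (Fin n) (Fin (2*n+1)) ℝ :=
  Matrix.of fun i j => A.mulVec (fun r => X r j) i + u i

/-- Deviation matrix `X̃ = X − (X·W)·1ᵀ`. -/
noncomputable def devMat {q m : ℕ} (w : Fin m → ℝ) (X : Matrix (Fin q) (Fin m) ℝ) :
    Matrix (Fin q) (Fin m) ℝ :=
  X - Matrix.vecMulVec (X.mulVec w) (fun _ => 1)

/-- Posterior covariance as a function of the gain: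
`P(K̂) = P_prior + K̂·R̄·K̂ᵀ − K̂·C·P_prior − P_prior·Cᵀ·K̂ᵀ`. -/
noncomputable def postCov {n p : ℕ} (Pprior : Matrix (Fin n) (Fin n) ℝ)
    (C : Matrix (Fin p) (Fin n) ℝ) (Rbar : Matrix (Fin p) (Fin p) ℝ)
    (K : Matrix (Fin n) (Fin p) ℝ) : Matrix (Fin n) (Fin n) ℝ :=
  Pprior + K * Rbar * Kᵀ - K * C * Pprior - Pprior * Cᵀ * Kᵀ

theorem Fin.sum_univ_two_mul_add_one {M : Type*} [AddCommMonoid M] {n : ℕ}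
    (f : Fin (2 * n + 1) → M) :
    ∑ j, f j = f 0 +
      (∑ i : Fin n, f ⟨i + 1, by omega⟩ + ∑ i : Fin n, f ⟨n + i + 1, by omega⟩) := by
  rw [Fin.sum_univ_succ, ← (finCongr (two_mul n).symm).sum_comp, Fin.sum_univ_add]
  rfl

theorem ukfW_zero (n : ℕ) (α : ℝ) : ukfW n α 0 = (α ^ 2 - 1) / α ^ 2 := by
  simp [ukfW]

theorem ukfW_succ (n : ℕ) (α : ℝ) (k : ℕ) (hk : k + 1 < 2 * n + 1) :
    ukfW n α ⟨k + 1, hk⟩ = 1 / (2 * α ^ 2 * n) := by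
  simp [ukfW]

theorem ukfDelta_zero (n : ℕ) (α : ℝ) (B : Matrix (Fin n) (Fin n) ℝ) (i : Fin n) :
    ukfDelta n α B i 0 = 0 := by
  simp [ukfDelta]

theorem ukfDelta_left (n : ℕ) (α : ℝ) (B : Matrix (Fin n) (Fin n) ℝ) (i k : Fin n) :
    ukfDelta n α B i ⟨k + 1, by omega⟩ = α * B i k := by
  simp [ukfDelta]

theorem ukfDelta_right (n : ℕ) (α : ℝ) (B : Matrix (Fin n) (Fin n) ℝ) (i k : Fin n) :
    ukfDelta n α B i ⟨n + k + 1, by omega⟩ = -(α * B i k) := by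
  have h : ¬ n + (k : ℕ) + 1 ≤ n := by omega
  have h' : n + (k : ℕ) + 1 - n - 1 = k := by omega
  simp [ukfDelta, h, h']

theorem sum_ukfW {n : ℕ} (hn : 0 < n) {α : ℝ} (hα : α ≠ 0) : ∑ j, ukfW n α j = 1 := by
  have : (n : ℝ) ≠ 0 := by positivity
  simp only [Fin.sum_univ_two_mul_add_one, ukfW_zero, ukfW_succ, Finset.sum_const,
    Finset.card_univ, Fintype.card_fin, nsmul_eq_mul]
  field_simp
  ring

theorem ukfDelta_mulVec_ukfW (n : ℕ) (α : ℝ) (B : Matrix (Fin n) (Fin n) ℝ) :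
    ukfDelta n α B *ᵥ ukfW n α = 0 := by
  ext i
  simp [mulVec, dotProduct, Fin.sum_univ_two_mul_add_one, ukfDelta_zero, ukfDelta_left,
    ukfDelta_right, ukfW_succ]

theorem ukfDelta_mul_diagonal_mul_transpose (n : ℕ) {α : ℝ} (hα : α ≠ 0)
    (B : Matrix (Fin n) (Fin n) ℝ) :
    ukfDelta n α B * diagonal (ukfW n α) * (ukfDelta n α B)ᵀ = (n : ℝ)⁻¹ • (B * Bᵀ) := by
  ext i j
  rw [mul_apply, Matrix.smul_apply, mul_apply]
  simp only [mul_diagonal, transpose_apply, Fin.sum_univ_two_mul_add_one, ukfDelta_zero,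
    ukfDelta_left, ukfDelta_right, ukfW_succ, smul_eq_mul, Finset.mul_sum,
    ← Finset.sum_add_distrib, zero_mul, zero_add]
  refine Finset.sum_congr rfl fun k _ => ?_
  field_simp
  ring

theorem propagate_sigmaPts {n : ℕ} (A : Matrix (Fin n) (Fin n) ℝ) (u xhat : Fin n → ℝ) (α : ℝ)
    (B : Matrix (Fin n) (Fin n) ℝ) :
    propagate A u (sigmaPts xhat α B) =
      A * ukfDelta n α B + vecMulVec (A *ᵥ xhat + u) (fun _ => 1) := by
  ext i j
  simp only [propagate, sigmaPts, mulVec, dotProduct, of_apply, Matrix.add_apply, mul_apply,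
    vecMulVec_apply, Pi.add_apply, mul_add, Finset.sum_add_distrib]
  ring

theorem devMat_add_vecMulVec_one {q m : ℕ} {w : Fin m → ℝ} (hw : ∑ j, w j = 1)
    {M : Matrix (Fin q) (Fin m) ℝ} (hM : M *ᵥ w = 0) (v : Fin q → ℝ) :
    devMat w (M + vecMulVec v fun _ => 1) = M := by
  have h : (vecMulVec v fun _ => (1 : ℝ)) *ᵥ w = v := by
    ext i
    simp [mulVec, dotProduct, vecMulVec_apply, ← Finset.mul_sum, hw]
  rw [devMat, add_mulVec, hM, h, zero_add, add_sub_cancel_right]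

theorem stmt17 {n p : ℕ} (hn : 0 < n) (hp : 0 < p)
    (A : Matrix (Fin n) (Fin n) ℝ) (hA : IsUnit A)
    (C : Matrix (Fin p) (Fin n) ℝ)
    (Q P : Matrix (Fin n) (Fin n) ℝ) (R : Matrix (Fin p) (Fin p) ℝ)
    (hQ : Q.PosSemidef) (hR : R.PosDef) (hP : P.PosSemidef)
    (xhat u : Fin n → ℝ) (α : ℝ) (hα : α ≠ 0)
    (Pprior : Matrix (Fin n) (Fin n) ℝ) (hPprior : Pprior = A * P * Aᵀ + Q)
    (Rbar : Matrix (Fin p) (Fin p) ℝ) (hRbar : Rbar = C * Pprior * Cᵀ + R)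
    (B : Matrix (Fin n) (Fin n) ℝ)
    (hB : B * Bᵀ = (n : ℝ) • (P + A⁻¹ * Q * (A⁻¹)ᵀ))
    (X' : Matrix (Fin n) (Fin (2*n+1)) ℝ) (hX' : X' = propagate A u (sigmaPts xhat α B))
    (Xt : Matrix (Fin n) (Fin (2*n+1)) ℝ) (hXt : Xt = devMat (ukfW n α) X')
    (Yt : Matrix (Fin p) (Fin (2*n+1)) ℝ) (hYt : Yt = devMat (ukfW n α) (C * X'))
    (PpA : Matrix (Fin n) (Fin n) ℝ) (hPpA : PpA = Xt * Matrix.diagonal (ukfW n α) * Xtᵀ)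
    (PzA : Matrix (Fin p) (Fin p) ℝ)
    (hPzA : PzA = Yt * Matrix.diagonal (ukfW n α) * Ytᵀ + R)
    (PezA : Matrix (Fin n) (Fin p) ℝ)
    (hPezA : PezA = Xt * Matrix.diagonal (ukfW n α) * Ytᵀ) :
    PpA = Pprior ∧
    PzA = C * Pprior * Cᵀ + R ∧
    PezA = Pprior * Cᵀ ∧
    PezA * PzA⁻¹ = Pprior * Cᵀ * Rbar⁻¹ ∧
    PpA - PezA * PzA⁻¹ * PezAᵀ =
      Pprior - Pprior * Cᵀ * Rbar⁻¹ * C * Pprior := by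
  have hn' : (n : ℝ) ≠ 0 := by positivity
  have hdet : IsUnit A.det := (Matrix.isUnit_iff_isUnit_det A).mp hA
  set D := ukfDelta n α B
  set W := ukfW n α
  have hw : ∑ j, W j = 1 := sum_ukfW hn hα
  have hDW : D *ᵥ W = 0 := ukfDelta_mulVec_ukfW n α B
  have hXt' : Xt = A * D := by
    rw [hXt, hX', propagate_sigmaPts]
    exact devMat_add_vecMulVec_one hw (by rw [← mulVec_mulVec, hDW, mulVec_zero]) _
  have hYt' : Yt = C * (A * D) := by
    rw [hYt, hX', propagate_sigmaPts, Matrix.mul_add, mul_vecMulVec]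
    exact devMat_add_vecMulVec_one hw
      (by rw [← mulVec_mulVec, ← mulVec_mulVec, hDW, mulVec_zero, mulVec_zero]) _
  have hcov : D * diagonal W * Dᵀ = P + A⁻¹ * Q * (A⁻¹)ᵀ := by
    rw [ukfDelta_mul_diagonal_mul_transpose n hα, hB, inv_smul_smul₀ hn']
  have hprior : A * D * diagonal W * (A * D)ᵀ = Pprior := by
    calc A * D * diagonal W * (A * D)ᵀ = A * (D * diagonal W * Dᵀ) * Aᵀ := by
          simp only [transpose_mul, Matrix.mul_assoc]
      _ = A * P * Aᵀ + (A * A⁻¹) * Q * (A * A⁻¹)ᵀ := by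
          rw [hcov]
          simp only [transpose_mul, Matrix.mul_add, Matrix.add_mul, Matrix.mul_assoc]
      _ = Pprior := by simp [mul_nonsing_inv A hdet, hPprior]
  have h1 : PpA = Pprior := by rw [hPpA, hXt', hprior]
  have h2 : PzA = C * Pprior * Cᵀ + R := by
    rw [hPzA, hYt', ← hprior]
    simp only [transpose_mul, Matrix.mul_assoc]
  have h3 : PezA = Pprior * Cᵀ := by
    rw [hPezA, hXt', hYt', ← hprior]
    simp only [transpose_mul, Matrix.mul_assoc]
  have hsymm : Ppriorᵀ = Pprior := by
    rw [← hprior]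
    simp only [transpose_mul, transpose_transpose, diagonal_transpose, Matrix.mul_assoc]
  refine ⟨h1, h2, h3, by rw [h3, h2, hRbar], ?_⟩
  rw [h1, h3, h2, ← hRbar, transpose_mul, transpose_transpose, hsymm]
  simp only [Matrix.mul_assoc]
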